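/- Let n ≥ 3 be odd and let d_s be the linear ℂ-derivation of B_n^2 whose associated matrix B is the n×n skew-symmetric matrix with last column (−1, −i, −1, −i, …, −1, −i, 0)ᵀ, last row (1, i, 1, i, …, 1, i, 0), and all other entries 0 (i the imaginary unit). Then B³ = 0, d_s is locally nilpotent, and for the scalar derivation d_1 given by d_1(x_j) = x_j for all j, the derivation d = d_1 + d_s satisfies ker(d) = ℂ. -/

import Mathlib

open MvPolynomial

noncomputable section

/-- The Fermat ring `B_n^m = ℂ[X_1,…,X_n]/(X_1^{m_1}+⋯+X_n^{m_n})`. -/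
abbrev FermatRing (n : ℕ) (m : Fin n → ℕ) : Type :=
  MvPolynomial (Fin n) ℂ ⧸
    Ideal.span {(∑ i, X i ^ m i : MvPolynomial (Fin n) ℂ)}

/-- The image `x_i` of the variable `X_i` in the Fermat ring. -/
def fx (n : ℕ) (m : Fin n → ℕ) (i : Fin n) : FermatRing n m :=
  Ideal.Quotient.mk _ (X i)

namespace Derivation

variable {R A : Type*} [CommRing R] [CommRing A] [Algebra R A]

/-- Products of elements killed by powers of a derivation are killed by a power of it. -/
theorem iterate_add_mul_eq_zero (D : Derivation R A A) (p q : ℕ) (a b : A)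
    (ha : (⇑D)^[p] a = 0) (hb : (⇑D)^[q] b = 0) : (⇑D)^[p + q] (a * b) = 0 := by
  have hz (t : ℕ) : (⇑D)^[t] 0 = 0 := Function.iterate_fixed (map_zero D) t
  induction p generalizing a b q with
  | zero =>
    obtain rfl : a = 0 := ha
    rw [zero_mul, hz]
  | succ p ihp =>
    induction q generalizing b with
    | zero =>
      obtain rfl : b = 0 := hb
      rw [mul_zero, hz]
    | succ q ihq =>
      rw [← add_assoc, Function.iterate_succ_apply, D.leibniz, smul_eq_mul, smul_eq_mul,
        iterate_map_add, mul_comm b, ihq (D b) hb, zero_add, add_right_comm, add_assoc]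
      exact ihp (q + 1) (D a) b ha hb

end Derivation

/-- If the commuting linear maps `f` and `g` have `(f + g) v = 0`, then `f` and `-g` have the same
iterates on `v`. -/
theorem Module.End.pow_apply_eq_of_add_apply_eq_zero {R M : Type*} [CommRing R] [AddCommGroup M]
    [Module R M] {f g : Module.End R M} (h : Commute f g) {v : M} (hv : f v + g v = 0) (t : ℕ) :
    (f ^ t) v = (-1 : R) ^ t • (g ^ t) v := by
  induction t with
  | zero => simp
  | succ t ih =>
    rw [pow_succ, Module.End.mul_apply, eq_neg_of_add_eq_zero_left hv, map_neg,
      ← Module.End.mul_apply, (h.pow_left t).eq, Module.End.mul_apply, ih, map_smul,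
      ← Module.End.mul_apply, ← pow_succ', pow_succ (-1 : R)]
    simp

section FermatRing

variable {n : ℕ} {m : Fin n → ℕ}

theorem FermatRing.derivation_ext {D E : Derivation ℂ (FermatRing n m) (FermatRing n m)}
    (h : ∀ j, D (fx n m j) = E (fx n m j)) : D = E := by
  ext r
  obtain ⟨p, rfl⟩ := Ideal.Quotient.mk_surjective r
  induction p using MvPolynomial.induction_on with
  | C a => exact (D.map_algebraMap a).trans (E.map_algebraMap a).symm
  | add p q hp hq => rw [map_add, map_add, map_add, hp, hq]
  | mul_X p j hp =>
    have hj : D (Ideal.Quotient.mk _ (X j)) = E (Ideal.Quotient.mk _ (X j)) := h j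
    rw [map_mul, D.leibniz, E.leibniz, hp, hj]

/-- A linear derivation of the Fermat ring acts on linear forms through its matrix. -/
theorem FermatRing.iterate_fx (s : Matrix (Fin n) (Fin n) ℂ)
    (D : Derivation ℂ (FermatRing n m) (FermatRing n m))
    (hD : ∀ j, D (fx n m j) = ∑ k, s j k • fx n m k) (t : ℕ) (j : Fin n) :
    (⇑D)^[t] (fx n m j) = ∑ k, (s ^ t) j k • fx n m k := by
  induction t with
  | zero => simp [Matrix.one_apply]
  | succ t ih =>
    rw [Function.iterate_succ_apply', ih, map_sum]
    simp only [D.map_smul, hD, pow_succ, Matrix.mul_apply, Finset.smul_sum, Finset.sum_smul,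
      smul_smul]
    exact Finset.sum_comm

/-- A linear derivation with nilpotent matrix is locally nilpotent. -/
theorem FermatRing.exists_iterate_eq_zero {s : Matrix (Fin n) (Fin n) ℂ} {N : ℕ} (hs : s ^ N = 0)
    {D : Derivation ℂ (FermatRing n m) (FermatRing n m)}
    (hD : ∀ j, D (fx n m j) = ∑ k, s j k • fx n m k) (r : FermatRing n m) :
    ∃ t : ℕ, (⇑D)^[t] r = 0 := by
  have hz (t : ℕ) : (⇑D)^[t] 0 = 0 := Function.iterate_fixed (map_zero D) t
  obtain ⟨p, rfl⟩ := Ideal.Quotient.mk_surjective r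
  induction p using MvPolynomial.induction_on with
  | C a => exact ⟨1, D.map_algebraMap a⟩
  | add p q hp hq =>
    obtain ⟨t, ht⟩ := hp
    obtain ⟨u, hu⟩ := hq
    refine ⟨t + u, ?_⟩
    rw [map_add, iterate_map_add, Function.iterate_add_apply _ t u (Ideal.Quotient.mk _ q), hu, hz,
      add_comm t, Function.iterate_add_apply, ht, hz, add_zero]
  | mul_X p j hp =>
    obtain ⟨t, ht⟩ := hp
    refine ⟨t + N, ?_⟩
    rw [map_mul]
    refine D.iterate_add_mul_eq_zero t N _ _ ht ?_
    refine (FermatRing.iterate_fx s D hD N j).trans ?_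
    simp [hs]

/-- The Euler derivation multiplies each monomial by its degree. -/
theorem FermatRing.euler_monomial {E : Derivation ℂ (FermatRing n m) (FermatRing n m)}
    (hE : ∀ j, E (fx n m j) = fx n m j) (u : Fin n →₀ ℕ) (a : ℂ) :
    ∃ k : ℕ, (E (Ideal.Quotient.mk _ (monomial u a)) =
        (k : ℂ) • (Ideal.Quotient.mk _ (monomial u a) : FermatRing n m)) ∧
      (k = 0 → ∃ c, monomial u a = C c) := by
  refine MvPolynomial.induction_on_monomial (motive := fun p => ∃ k : ℕ,
    (E (Ideal.Quotient.mk _ p) = (k : ℂ) • (Ideal.Quotient.mk _ p : FermatRing n m)) ∧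
      (k = 0 → ∃ c, p = C c)) (fun a => ⟨0, ?_, fun _ => ⟨a, rfl⟩⟩) ?_ u a
  · rw [Nat.cast_zero, zero_smul]
    exact E.map_algebraMap a
  · rintro p j ⟨k, hk, -⟩
    refine ⟨k + 1, ?_, by simp⟩
    have hj : E (Ideal.Quotient.mk _ (X j)) = Ideal.Quotient.mk _ (X j) := hE j
    rw [map_mul, E.leibniz, hk, hj, smul_eq_mul, smul_eq_mul, mul_smul_comm, Nat.cast_add,
      Nat.cast_one, add_smul, one_smul, mul_comm (Ideal.Quotient.mk _ (X j)), add_comm]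

/-- Up to a constant, every element is annihilated by a polynomial in the Euler derivation with
nonzero constant term. -/
theorem FermatRing.exists_aeval_euler_eq_zero
    {E : Derivation ℂ (FermatRing n m) (FermatRing n m)}
    (hE : ∀ j, E (fx n m j) = fx n m j) (f : FermatRing n m) :
    ∃ (c : ℂ) (P : Polynomial ℂ), P.eval 0 ≠ 0 ∧
      Polynomial.aeval (E : Module.End ℂ (FermatRing n m)) P (f - algebraMap ℂ _ c) = 0 := by
  obtain ⟨p, rfl⟩ := Ideal.Quotient.mk_surjective f
  induction p using MvPolynomial.induction_on' with
  | monomial u a =>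
    obtain ⟨k, h, hk⟩ := FermatRing.euler_monomial hE u a
    obtain rfl | hk' := eq_or_ne k 0
    · obtain ⟨c, hc⟩ := hk rfl
      refine ⟨c, 1, by simp, ?_⟩
      rw [hc, sub_eq_zero.mpr (by rfl), map_zero]
    · refine ⟨0, Polynomial.X - Polynomial.C (k : ℂ), by simpa using hk', ?_⟩
      rw [map_zero, sub_zero, map_sub, Polynomial.aeval_X, Polynomial.aeval_C, LinearMap.sub_apply,
        Module.algebraMap_end_apply, Derivation.coeFn_coe, h, sub_self]
  | add p q hp hq =>
    obtain ⟨c, P, hP, hcP⟩ := hp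
    obtain ⟨b, Q, hQ, hbQ⟩ := hq
    refine ⟨c + b, P * Q, by simp [hP, hQ], ?_⟩
    rw [map_add, map_add, add_sub_add_comm, map_add, mul_comm P, map_mul, Module.End.mul_apply,
      hcP, ← map_mul, mul_comm Q, map_mul, Module.End.mul_apply, hbQ, map_zero, map_zero, add_zero]

/-- The generalized kernel of the Euler derivation consists of constants. -/
theorem FermatRing.mem_range_of_euler_pow_eq_zero
    {E : Derivation ℂ (FermatRing n m) (FermatRing n m)}
    (hE : ∀ j, E (fx n m j) = fx n m j) {f : FermatRing n m} {t : ℕ}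
    (hf : ((E : Module.End ℂ (FermatRing n m)) ^ t) f = 0) :
    f ∈ Set.range (algebraMap ℂ (FermatRing n m)) := by
  obtain ⟨c, P, hP, hcP⟩ := FermatRing.exists_aeval_euler_eq_zero hE f
  refine ⟨c, ?_⟩
  have hcop : IsCoprime (Polynomial.X ^ (t + 1)) P := by
    refine IsCoprime.pow_left ?_
    refine (Polynomial.irreducible_X (R := ℂ)).coprime_iff_not_dvd.mpr ?_
    rwa [Polynomial.X_dvd_iff, Polynomial.coeff_zero_eq_eval_zero]
  have hX : Polynomial.aeval (E : Module.End ℂ (FermatRing n m))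
      ((Polynomial.X : Polynomial ℂ) ^ (t + 1))
      (f - algebraMap ℂ _ c) = 0 := by
    rw [map_pow, Polynomial.aeval_X, map_sub, pow_succ', Module.End.mul_apply, hf, map_zero,
      ← pow_succ', pow_succ, Module.End.mul_apply, Derivation.coeFn_coe, E.map_algebraMap,
      map_zero, sub_zero]
  exact (sub_eq_zero.mp (Submodule.disjoint_def.mp
    (Polynomial.disjoint_ker_aeval_of_isCoprime _ hcop) _ hX hcP)).symm

/-- A linear derivation with nilpotent matrix, added to the Euler derivation, has only constants
in its kernel. -/
theorem FermatRing.ker_euler_add_eq_range {s : Matrix (Fin n) (Fin n) ℂ} {N : ℕ} (hs : s ^ N = 0)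
    {D E : Derivation ℂ (FermatRing n m) (FermatRing n m)}
    (hD : ∀ j, D (fx n m j) = ∑ k, s j k • fx n m k) (hE : ∀ j, E (fx n m j) = fx n m j) :
    {f : FermatRing n m | (E + D) f = 0} = Set.range (algebraMap ℂ (FermatRing n m)) := by
  ext f
  constructor
  · intro hf
    obtain ⟨t, ht⟩ := FermatRing.exists_iterate_eq_zero hs hD f
    have hbr : ⁅E, D⁆ = 0 := FermatRing.derivation_ext fun j => by
      simp [Derivation.commutator_apply, hD, hE, map_sum]
    have hcomm : Commute (E : Module.End ℂ (FermatRing n m)) (D : Module.End ℂ (FermatRing n m)) :=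
      LinearMap.ext fun r => by
        have := DFunLike.congr_fun hbr r
        rwa [Derivation.commutator_apply, Derivation.zero_apply, sub_eq_zero] at this
    refine FermatRing.mem_range_of_euler_pow_eq_zero hE (t := t) ?_
    rw [Module.End.pow_apply_eq_of_add_apply_eq_zero hcomm hf, Module.End.pow_apply]
    exact (congrArg _ ht).trans (smul_zero _)
  · rintro ⟨c, rfl⟩
    exact (E + D).map_algebraMap c

end FermatRing

/-- The matrix `e cᵀ - c eᵀ` has vanishing cube if `c` is isotropic and orthogonal to `e`. -/
theorem Matrix.vecMulVec_sub_vecMulVec_pow_three {ι R : Type*} [Fintype ι] [DecidableEq ι]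
    [CommRing R] {e c : ι → R} (hcc : c ⬝ᵥ c = 0) (hec : e ⬝ᵥ c = 0) :
    (Matrix.vecMulVec e c - Matrix.vecMulVec c e) ^ 3 = 0 := by
  have hce : c ⬝ᵥ e = 0 := by rw [dotProduct_comm, hec]
  simp [pow_succ, sub_mul, mul_sub, Matrix.vecMulVec_mul_vecMulVec, hcc, hec, hce]

theorem sum_range_even_alternating (k : ℕ) :
    ∑ i ∈ Finset.range (2 * k), (if i % 2 = 0 then (1 : ℂ) else Complex.I) ^ 2 = 0 := by
  induction k with
  | zero => simp
  | succ k ih =>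
    rw [mul_add, mul_one, Finset.sum_range_succ, Finset.sum_range_succ, ih]
    simp [Nat.add_mod]

/-- For odd `n ≥ 3`, the skew-symmetric matrix `B` with last
column `(−1, −i, −1, −i, …, 0)ᵀ`, last row `(1, i, 1, i, …, 0)` and zeros
elsewhere satisfies `B³ = 0`; the associated derivation `d_s` of `B_n^2` is
locally nilpotent, and `d = d_1 + d_s` (with `d_1(x_j) = x_j`) has trivial ring
of constants. -/
theorem odd_example_trivial_constants
    (n : ℕ) (hn : 3 ≤ n) (hodd : Odd n)
    (s : Matrix (Fin n) (Fin n) ℂ)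
    (hs : s = fun j k =>
      if j = (⟨n - 1, by omega⟩ : Fin n) then
        (if k = (⟨n - 1, by omega⟩ : Fin n) then 0
         else if (k : ℕ) % 2 = 0 then 1 else Complex.I)
      else if k = (⟨n - 1, by omega⟩ : Fin n) then
        (if (j : ℕ) % 2 = 0 then -1 else -Complex.I)
      else 0)
    (ds : Derivation ℂ (FermatRing n fun _ => 2) (FermatRing n fun _ => 2))
    (hds : ∀ j, ds (fx n (fun _ => 2) j) = ∑ k, s j k • fx n (fun _ => 2) k)
    (d1 : Derivation ℂ (FermatRing n fun _ => 2) (FermatRing n fun _ => 2))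
    (hd1 : ∀ j, d1 (fx n (fun _ => 2) j) = fx n (fun _ => 2) j) :
    s ^ 3 = 0 ∧
    (∀ r : FermatRing n fun _ => 2, ∃ t : ℕ, (⇑ds)^[t] r = 0) ∧
    {f : FermatRing n fun _ => 2 | (d1 + ds) f = 0} =
      Set.range (algebraMap ℂ (FermatRing n fun _ => 2)) := by
  have hs3 : s ^ 3 = 0 := by
    obtain ⟨k, rfl⟩ := hodd
    set l : Fin (2 * k + 1) := ⟨2 * k + 1 - 1, by omega⟩
    set c : Fin (2 * k + 1) → ℂ := fun i =>
      if i = l then 0 else if (i : ℕ) % 2 = 0 then 1 else Complex.I with hc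
    have hsc : s = Matrix.vecMulVec (Pi.single l 1) c - Matrix.vecMulVec c (Pi.single l 1) := by
      rw [hs]
      ext i j
      rw [Matrix.sub_apply, Matrix.vecMulVec_apply, Matrix.vecMulVec_apply, Pi.single_apply,
        Pi.single_apply]
      simp only [hc]
      split_ifs <;> ring
    rw [hsc]
    refine Matrix.vecMulVec_sub_vecMulVec_pow_three ?_ (by simp [hc])
    have hlast : l = Fin.last (2 * k) := rfl
    rw [dotProduct, Fin.sum_univ_castSucc]
    simp only [hc, hlast, (Fin.castSucc_lt_last _).ne, if_false, if_true,
      Fin.val_castSucc, mul_zero, add_zero]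
    simp only [← sq]
    rw [Fin.sum_univ_eq_sum_range (fun i => (if i % 2 = 0 then (1 : ℂ) else Complex.I) ^ 2),
      sum_range_even_alternating]
  exact ⟨hs3, FermatRing.exists_iterate_eq_zero hs3 hds,
    FermatRing.ker_euler_add_eq_range hs3 hds hd1⟩
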